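/- arXiv:1006.3021 — 9 statements merged into one kernel-verified Lean document; each statement's English description precedes it below -/
import Mathlib

section
/- If φ is a factual propositional formula, (X,Y) is an HT-interpretation with (X,Y) ⊨ φ, and X ⊆ X' ⊆ Y, then (X',Y) ⊨ φ. -/
/-- Propositional formulas over atoms of type `α`. -/
inductive PForm (α : Type) : Type where
  | atom : α → PForm α
  | bot  : PForm α
  | conj : PForm α → PForm α → PForm α
  | disj : PForm α → PForm α → PForm α
  | impl : PForm α → PForm α → PForm α

namespace PForm

variable {α : Type}

/-- Classical satisfaction by a set of atoms. -/
def clSat (Y : Set α) : PForm α → Prop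
  | atom a   => a ∈ Y
  | bot      => False
  | conj φ ψ => clSat Y φ ∧ clSat Y ψ
  | disj φ ψ => clSat Y φ ∨ clSat Y ψ
  | impl φ ψ => clSat Y φ → clSat Y ψ

/-- HT-satisfaction by a pair (X,Y) of sets of atoms. -/
def htSat (X Y : Set α) : PForm α → Prop
  | atom a   => a ∈ X
  | bot      => False
  | conj φ ψ => htSat X Y φ ∧ htSat X Y ψ
  | disj φ ψ => htSat X Y φ ∨ htSat X Y ψ
  | impl φ ψ => (htSat X Y φ → htSat X Y ψ) ∧ (clSat Y φ → clSat Y ψ)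

/-- Factual formulas: built from ∧, ∨, ⊥ and negations φ → ⊥ only. -/
def Factual : PForm α → Prop
  | atom _   => True
  | bot      => True
  | conj φ ψ => Factual φ ∧ Factual ψ
  | disj φ ψ => Factual φ ∧ Factual ψ
  | impl φ ψ => Factual φ ∧ ψ = PForm.bot

/-- All atoms of the formula belong to `L`. -/
def atomsIn (L : Set α) : PForm α → Prop
  | atom a   => a ∈ L
  | bot      => True
  | conj φ ψ => atomsIn L φ ∧ atomsIn L ψ
  | disj φ ψ => atomsIn L φ ∧ atomsIn L ψ
  | impl φ ψ => atomsIn L φ ∧ atomsIn L ψ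

end PForm

abbrev Theory (α : Type) := Set (PForm α)

variable {α : Type}

/-- An HT-interpretation (X,Y) satisfies a theory. -/
def htSatT (X Y : Set α) (Γ : Theory α) : Prop := ∀ φ ∈ Γ, PForm.htSat X Y φ

/-- Classical satisfaction of a theory. -/
def clSatT (Y : Set α) (Γ : Theory α) : Prop := ∀ φ ∈ Γ, PForm.clSat Y φ

/-- A factual theory. -/
def FactualT (Γ : Theory α) : Prop := ∀ φ ∈ Γ, PForm.Factual φ

/-- Y is an answer set of Γ, i.e. (Y,Y) is an equilibrium model of Γ. -/
def IsAnswerSet (Γ : Theory α) (Y : Set α) : Prop :=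
  htSatT Y Y Γ ∧ ∀ X, X ⊂ Y → ¬ htSatT X Y Γ

/-- Answer-set equivalence. -/
def AnswerEquiv (Γ₁ Γ₂ : Theory α) : Prop :=
  ∀ Y : Set α, IsAnswerSet Γ₁ Y ↔ IsAnswerSet Γ₂ Y

/-- Classical equivalence. -/
def ClassEquiv (Γ₁ Γ₂ : Theory α) : Prop :=
  ∀ Y : Set α, clSatT Y Γ₁ ↔ clSatT Y Γ₂

/-- Strong equivalence. -/
def StrongEquiv (Γ₁ Γ₂ : Theory α) : Prop :=
  ∀ Γ : Theory α, AnswerEquiv (Γ₁ ∪ Γ) (Γ₂ ∪ Γ)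

/-- Uniform equivalence (wrt factual theories). -/
def UnifEquiv (Γ₁ Γ₂ : Theory α) : Prop :=
  ∀ Γ : Theory α, FactualT Γ → AnswerEquiv (Γ₁ ∪ Γ) (Γ₂ ∪ Γ)

/-- The set of HT-countermodels of Γ. -/
def Cs (Γ : Theory α) : Set (Set α × Set α) :=
  {p | p.1 ⊆ p.2 ∧ ¬ htSatT p.1 p.2 Γ}

/-- The set of equivalence interpretations of Γ: total HT-models and here-countermodels. -/
def Es (Γ : Theory α) : Set (Set α × Set α) :=
  {p | p.1 ⊆ p.2 ∧
    ((p.1 = p.2 ∧ htSatT p.1 p.2 Γ) ∨ (¬ htSatT p.1 p.2 Γ ∧ clSatT p.2 Γ))}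

/-- (X,Y) is there-closed in a set S of HT-interpretations. -/
def ThereClosedIn (S : Set (Set α × Set α)) (X Y : Set α) : Prop :=
  (Y, Y) ∉ S ∧ ∀ X', X ⊆ X' → X' ⊂ Y → (X', Y) ∈ S

/-- (X,Y) is closed in a set S of HT-interpretations. -/
def ClosedIn (S : Set (Set α × Set α)) (X Y : Set α) : Prop :=
  ∀ X', X ⊆ X' → X' ⊆ Y → (X', Y) ∈ S

/-- C_u(Γ): there-closed HT-interpretations wrt the countermodels of Γ. -/
def Cu (Γ : Theory α) : Set (Set α × Set α) :=
  {p | p.1 ⊆ p.2 ∧ ThereClosedIn (Cs Γ) p.1 p.2}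


theorem htSat_to_clSat_aux (X Y : Set α) (h : X ⊆ Y) (φ : PForm α) :
    PForm.htSat X Y φ → PForm.clSat Y φ := by
  induction φ with
  | atom a => exact fun ha => h ha
  | bot => exact fun hb => hb
  | conj φ ψ ih1 ih2 => exact fun hc => ⟨ih1 hc.1, ih2 hc.2⟩
  | disj φ ψ ih1 ih2 => exact fun hd => Or.imp ih1 ih2 hd
  | impl φ ψ _ _ => exact fun hi => hi.2

/-- If φ is a factual propositional formula, (X,Y) is an HT-interpretation
with (X,Y) ⊨ φ, and X ⊆ X' ⊆ Y, then (X',Y) ⊨ φ. -/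
theorem factual_htSat_persistence (φ : PForm α) (hfac : PForm.Factual φ)
    (X X' Y : Set α) (hXY : X ⊆ Y) (hsat : PForm.htSat X Y φ)
    (hXX' : X ⊆ X') (hX'Y : X' ⊆ Y) : PForm.htSat X' Y φ := by
  induction φ with
  | atom a => exact hXX' hsat
  | bot => exact hsat
  | conj φ ψ ih1 ih2 => exact ⟨ih1 hfac.1 hsat.1, ih2 hfac.2 hsat.2⟩
  | disj φ ψ ih1 ih2 => exact Or.imp (ih1 hfac.1) (ih2 hfac.2) hsat
  | impl φ ψ _ _ =>
    obtain ⟨_, rfl⟩ := hfac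
    exact ⟨fun h => hsat.2 (htSat_to_clSat_aux X' Y hX'Y φ h), hsat.2⟩
end

section
/- Two propositional theories Γ1 and Γ2 are uniformly equivalent if and only if they have the same sets of there-closed HT-countermodels, i.e., Γ1 ≡_u Γ2 iff C_u(Γ1) = C_u(Γ2). -/
variable {α : Type}

theorem htSat_clSat_aux {X Y : Set α} (h : X ⊆ Y) (φ : PForm α) :
    PForm.htSat X Y φ → PForm.clSat Y φ := by
  induction φ with
  | atom a => exact fun ha => h ha
  | bot => exact id
  | conj φ ψ h1 h2 => exact fun H => ⟨h1 H.1, h2 H.2⟩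
  | disj φ ψ h1 h2 => exact fun H => H.imp h1 h2
  | impl φ ψ h1 h2 => exact fun H => H.2

theorem factual_mono_aux {X X' Y : Set α} (h : X ⊆ X') (h' : X' ⊆ Y) (φ : PForm α) :
    PForm.Factual φ → PForm.htSat X Y φ → PForm.htSat X' Y φ := by
  induction φ with
  | atom a => exact fun _ ha => h ha
  | bot => exact fun _ => id
  | conj φ ψ h1 h2 => exact fun F H => ⟨h1 F.1 H.1, h2 F.2 H.2⟩
  | disj φ ψ h1 h2 => exact fun F H => H.imp (h1 F.1) (h2 F.2)
  | impl φ ψ h1 h2 =>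
    rintro ⟨_, rfl⟩ H
    exact ⟨fun K => H.2 (htSat_clSat_aux h' φ K), H.2⟩

theorem htSatT_union_aux (X Y : Set α) (Γ Δ : Theory α) :
    htSatT X Y (Γ ∪ Δ) ↔ htSatT X Y Γ ∧ htSatT X Y Δ := by
  constructor
  · exact fun H => ⟨fun φ h => H φ (Or.inl h), fun φ h => H φ (Or.inr h)⟩
  · rintro ⟨H, K⟩ φ (h | h)
    · exact H φ h
    · exact K φ h

theorem mem_Cu_aux (Γ : Theory α) (X Y : Set α) :
    (X, Y) ∈ Cu Γ ↔ X ⊆ Y ∧ htSatT Y Y Γ ∧ ∀ X', X ⊆ X' → X' ⊂ Y → ¬ htSatT X' Y Γ := by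
  constructor
  · rintro ⟨h, h1, h2⟩
    exact ⟨h, by_contra fun H => h1 ⟨subset_rfl, H⟩, fun X' a b => (h2 X' a b).2⟩
  · rintro ⟨h, h1, h2⟩
    exact ⟨h, fun H => H.2 h1, fun X' a b => ⟨b.1, h2 X' a b⟩⟩

theorem htSatT_atoms_aux (X X' Y : Set α) :
    htSatT X' Y (PForm.atom '' X) ↔ X ⊆ X' := by
  constructor
  · exact fun H a ha => H _ ⟨a, ha, rfl⟩
  · rintro H _ ⟨a, ha, rfl⟩
    exact H ha

theorem mem_Cu_answer_aux (Γ : Theory α) (X Y : Set α) :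
    (X, Y) ∈ Cu Γ ↔ IsAnswerSet (Γ ∪ PForm.atom '' X) Y := by
  simp only [mem_Cu_aux, IsAnswerSet, htSatT_union_aux, htSatT_atoms_aux]
  constructor
  · rintro ⟨h, h1, h2⟩
    exact ⟨⟨h1, h⟩, fun X' a b => h2 X' b.2 a b.1⟩
  · rintro ⟨⟨h1, h⟩, h2⟩
    exact ⟨h, h1, fun X' a b c => h2 X' b ⟨c, a⟩⟩

theorem answer_of_Cu_aux {Γ₁ Γ₂ Γ : Theory α} (E : Cu Γ₁ = Cu Γ₂) (F : FactualT Γ) {Y : Set α}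
    (H : IsAnswerSet (Γ₁ ∪ Γ) Y) : IsAnswerSet (Γ₂ ∪ Γ) Y := by
  simp only [IsAnswerSet, htSatT_union_aux] at H ⊢
  obtain ⟨⟨h1, h2⟩, h3⟩ := H
  have hY : (Y, Y) ∈ Cu Γ₁ :=
    (mem_Cu_aux _ _ _).2 ⟨subset_rfl, h1, fun X' a b => absurd a b.2⟩
  rw [E, mem_Cu_aux] at hY
  refine ⟨⟨hY.2.1, h2⟩, ?_⟩
  rintro X hX ⟨k1, k2⟩
  have hC : (X, Y) ∈ Cu Γ₁ := (mem_Cu_aux _ _ _).2 ⟨hX.1, h1, fun X' a b c =>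
    h3 X' b ⟨c, fun φ hφ => factual_mono_aux a b.1 φ (F φ hφ) (k2 φ hφ)⟩⟩
  rw [E, mem_Cu_aux] at hC
  exact hC.2.2 X subset_rfl hX k1

/-- Two propositional theories are uniformly equivalent iff they have the
same sets of there-closed HT-countermodels: Γ₁ ≡ᵤ Γ₂ iff C_u(Γ₁) = C_u(Γ₂). -/
theorem uniform_equiv_iff_thereClosed_countermodels (Γ₁ Γ₂ : Theory α) :
    UnifEquiv Γ₁ Γ₂ ↔ Cu Γ₁ = Cu Γ₂ := by
  constructor
  · intro H
    ext ⟨X, Y⟩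
    rw [mem_Cu_answer_aux, mem_Cu_answer_aux]
    refine H _ ?_ Y
    rintro _ ⟨a, _, rfl⟩
    trivial
  · intro E Γ F Y
    exact ⟨answer_of_Cu_aux E F, answer_of_Cu_aux E.symm F⟩
end

section
/- Two propositional theories Γ1 and Γ2 have the same HT-countermodels if and only if they have the same equivalence interpretations, i.e., C_s(Γ1) = C_s(Γ2) iff E_s(Γ1) = E_s(Γ2). -/
variable {α : Type}

theorem aux_total (Y : Set α) (φ : PForm α) : PForm.htSat Y Y φ ↔ PForm.clSat Y φ := by
  induction φ with
  | atom a => simp [PForm.htSat, PForm.clSat]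
  | bot => simp [PForm.htSat, PForm.clSat]
  | conj φ ψ h1 h2 => simp [PForm.htSat, PForm.clSat, h1, h2]
  | disj φ ψ h1 h2 => simp [PForm.htSat, PForm.clSat, h1, h2]
  | impl φ ψ h1 h2 => simp [PForm.htSat, PForm.clSat, h1, h2]

theorem aux_pers (X Y : Set α) (hXY : X ⊆ Y) (φ : PForm α) :
    PForm.htSat X Y φ → PForm.clSat Y φ := by
  induction φ with
  | atom a => exact fun h => hXY h
  | bot => exact fun h => h
  | conj φ ψ h1 h2 => exact fun h => ⟨h1 h.1, h2 h.2⟩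
  | disj φ ψ h1 h2 => exact fun h => h.imp h1 h2
  | impl φ ψ h1 h2 => exact fun h => h.2

theorem aux_totalT (Y : Set α) (Γ : Theory α) : htSatT Y Y Γ ↔ clSatT Y Γ :=
  forall₂_congr fun φ _ => aux_total Y φ

theorem aux_persT (X Y : Set α) (hXY : X ⊆ Y) (Γ : Theory α) (h : htSatT X Y Γ) :
    clSatT Y Γ := fun φ hφ => aux_pers X Y hXY φ (h φ hφ)

theorem aux_Cs (Γ₁ Γ₂ : Theory α) : Cs Γ₁ = Cs Γ₂ ↔
    ∀ X Y : Set α, X ⊆ Y → (htSatT X Y Γ₁ ↔ htSatT X Y Γ₂) := by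
  simp only [Set.ext_iff, Cs, Set.mem_setOf_eq, Prod.forall]
  refine forall₂_congr fun X Y => ?_
  tauto

/-- Two propositional theories have the same HT-countermodels iff they have
the same equivalence interpretations: C_s(Γ₁) = C_s(Γ₂) iff E_s(Γ₁) = E_s(Γ₂). -/
theorem countermodels_eq_iff_equivalence_interpretations_eq (Γ₁ Γ₂ : Theory α) :
    Cs Γ₁ = Cs Γ₂ ↔ Es Γ₁ = Es Γ₂ := by
  rw [aux_Cs]
  constructor
  · intro h
    ext ⟨X, Y⟩
    have hc : clSatT Y Γ₁ ↔ clSatT Y Γ₂ := by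
      rw [← aux_totalT, ← aux_totalT]; exact h Y Y subset_rfl
    have := h X Y
    simp only [Es, Set.mem_setOf_eq]
    tauto
  · intro h X Y hXY
    have hc : clSatT Y Γ₁ ↔ clSatT Y Γ₂ := by
      have := Set.ext_iff.1 h (Y, Y)
      have h1 := aux_totalT Y Γ₁
      have h2 := aux_totalT Y Γ₂
      simp only [Es, Set.mem_setOf_eq, subset_rfl, true_and] at this
      tauto
    have h3 := Set.ext_iff.1 h (X, Y)
    have p1 := aux_persT X Y hXY Γ₁
    have p2 := aux_persT X Y hXY Γ₂
    simp only [Es, Set.mem_setOf_eq, hXY, true_and] at h3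
    by_cases e : X = Y
    · subst e
      rw [aux_totalT, aux_totalT]; exact hc
    · tauto
end

section
/- For any two propositional theories Γ1 and Γ2 and each e ∈ {c, a, s, u}, the following three propositions are equivalent: (1) Γ1 ≡_e Γ2; (2) C_e(Γ1) = C_e(Γ2); (3) E_e(Γ1) = E_e(Γ2). -/
variable {α : Type}

/-- C_c(Γ): total HT-interpretations in C_s(Γ). -/
def Cc (Γ : Theory α) : Set (Set α × Set α) := {p ∈ Cs Γ | p.1 = p.2}

/-- E_c(Γ): total HT-interpretations in E_s(Γ). -/
def Ec (Γ : Theory α) : Set (Set α × Set α) := {p ∈ Es Γ | p.1 = p.2}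

/-- C_a(Γ): there-closed HT-interpretations of the form (∅,Y) in C_s(Γ). -/
def Ca (Γ : Theory α) : Set (Set α × Set α) :=
  {p | p.1 = (∅ : Set α) ∧ ThereClosedIn (Cs Γ) p.1 p.2}

/-- E_a(Γ): total-closed HT-interpretations in E_s(Γ) (equilibrium models). -/
def Ea (Γ : Theory α) : Set (Set α × Set α) :=
  {p | p.1 = p.2 ∧ ∀ X, X ⊆ p.2 → (X, p.2) ∈ Es Γ}

/-- E_u(Γ): closed HT-interpretations in E_s(Γ). -/
def Eu (Γ : Theory α) : Set (Set α × Set α) :=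
  {p | p.1 ⊆ p.2 ∧ ClosedIn (Es Γ) p.1 p.2}

namespace HTAux

theorem sat_tot (Y : Set α) (φ : PForm α) : PForm.htSat Y Y φ ↔ PForm.clSat Y φ := by
  induction φ <;> simp_all [PForm.htSat, PForm.clSat]

theorem pers {X Y : Set α} (h : X ⊆ Y) (φ : PForm α) :
    PForm.htSat X Y φ → PForm.clSat Y φ := by
  induction φ with
  | atom a => exact fun ha => h ha
  | bot => exact id
  | conj φ ψ h1 h2 => exact fun ⟨a, b⟩ => ⟨h1 a, h2 b⟩
  | disj φ ψ h1 h2 => exact fun a => a.imp h1 h2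
  | impl φ ψ h1 h2 => exact fun a => a.2

theorem fact_mono {X X' Y : Set α} (h : X ⊆ X') (h' : X' ⊆ Y) (φ : PForm α)
    (hf : PForm.Factual φ) : PForm.htSat X Y φ → PForm.htSat X' Y φ := by
  induction φ with
  | atom a => exact fun ha => h ha
  | bot => exact id
  | conj φ ψ h1 h2 => exact fun ⟨a, b⟩ => ⟨h1 hf.1 a, h2 hf.2 b⟩
  | disj φ ψ h1 h2 => exact fun a => a.imp (h1 hf.1) (h2 hf.2)
  | impl φ ψ h1 h2 =>
    obtain ⟨_, rfl⟩ := hf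
    exact fun a => ⟨fun b => a.2 (pers h' φ b), a.2⟩

theorem totT (Y : Set α) (Γ : Theory α) : htSatT Y Y Γ ↔ clSatT Y Γ :=
  forall₂_congr fun φ _ => sat_tot Y φ

theorem persT {X Y : Set α} (h : X ⊆ Y) (Γ : Theory α) (hs : htSatT X Y Γ) :
    htSatT Y Y Γ := (totT Y Γ).2 fun φ hφ => pers h φ (hs φ hφ)

theorem unionT (X Y : Set α) (Γ Δ : Theory α) :
    htSatT X Y (Γ ∪ Δ) ↔ htSatT X Y Γ ∧ htSatT X Y Δ := by
  simp only [htSatT, Set.mem_union, or_imp, forall_and]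

/-- common characterization of `Cu` and `Eu` -/
def U (Γ : Theory α) (X Y : Set α) : Prop :=
  htSatT Y Y Γ ∧ ∀ X', X ⊆ X' → X' ⊂ Y → ¬ htSatT X' Y Γ

theorem there_iff (Γ : Theory α) (X Y : Set α) : ThereClosedIn (Cs Γ) X Y ↔ U Γ X Y := by
  simp only [ThereClosedIn, Cs, U, Set.mem_ofPred_eq, subset_rfl, true_and, not_not]
  exact and_congr_right fun _ =>
    forall₃_congr fun X' _ h => ⟨fun h => h.2, fun k => ⟨h.subset, k⟩⟩

theorem closed_iff (Γ : Theory α) {X Y : Set α} (h : X ⊆ Y) :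
    ClosedIn (Es Γ) X Y ↔ U Γ X Y := by
  simp only [ClosedIn, Es, U, Set.mem_ofPred_eq, ← totT]
  constructor
  · intro H
    refine ⟨?_, fun X' h1 h2 => ?_⟩
    · rcases (H Y h subset_rfl).2 with k | k
      · exact k.2
      · exact k.2
    · rcases (H X' h1 h2.subset).2 with k | k
      · exact absurd k.1 h2.ne
      · exact k.1
  · rintro ⟨H1, H2⟩ X' h1 h2
    refine ⟨h2, ?_⟩
    by_cases e : X' = Y
    · subst e; exact Or.inl ⟨rfl, H1⟩
    · exact Or.inr ⟨H2 X' h1 (h2.ssubset_of_ne e), H1⟩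

theorem ans_iff (Γ : Theory α) (Y : Set α) : IsAnswerSet Γ Y ↔ U Γ ∅ Y := by
  simp [IsAnswerSet, U]

def atoms (X : Set α) : Theory α := PForm.atom '' X

theorem atomsT (Z Y X : Set α) : htSatT Z Y (atoms X) ↔ X ⊆ Z := by
  simp [htSatT, atoms, PForm.htSat, Set.subset_def]

theorem ans_atoms (Γ : Theory α) {X Y : Set α} (h : X ⊆ Y) :
    IsAnswerSet (Γ ∪ atoms X) Y ↔ U Γ X Y := by
  simp only [IsAnswerSet, U, unionT, atomsT]
  constructor
  · exact fun H => ⟨H.1.1, fun X' h1 h2 h3 => H.2 X' h2 ⟨h3, h1⟩⟩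
  · exact fun H => ⟨⟨H.1, h⟩, fun X' h2 h3 => H.2 X' h3.2 h2 h3.1⟩

theorem ans_fact (Γ Δ : Theory α) (hΔ : FactualT Δ) (Y : Set α) :
    IsAnswerSet (Γ ∪ Δ) Y ↔ U Γ Y Y ∧ htSatT Y Y Δ ∧
      ∀ X, X ⊆ Y → htSatT X Y Δ → U Γ X Y := by
  simp only [IsAnswerSet, U, unionT]
  constructor
  · rintro ⟨⟨H1, H2⟩, H3⟩
    refine ⟨⟨H1, fun X' a b => absurd a b.2⟩, H2, fun X h1 h2 => ⟨H1, fun X' a b c => ?_⟩⟩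
    exact H3 X' b ⟨c, fun φ hφ => fact_mono a b.subset φ (hΔ φ hφ) (h2 φ hφ)⟩
  · rintro ⟨H1, H2, H3⟩
    exact ⟨⟨H1.1, H2⟩, fun X a b => (H3 X a.subset b.2).2 X subset_rfl a b.1⟩

theorem unif_iff (Γ₁ Γ₂ : Theory α) :
    UnifEquiv Γ₁ Γ₂ ↔ ∀ X Y : Set α, X ⊆ Y → (U Γ₁ X Y ↔ U Γ₂ X Y) := by
  constructor
  · intro H X Y h
    rw [← ans_atoms _ h, ← ans_atoms _ h]
    refine H _ ?_ Y
    rintro _ ⟨a, _, rfl⟩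
    trivial
  · intro H Δ hΔ Y
    rw [ans_fact _ _ hΔ, ans_fact _ _ hΔ, H Y Y subset_rfl]
    refine and_congr_right fun _ => and_congr_right fun _ => forall₂_congr fun X h => ?_
    rw [H X Y h]

theorem strong_aux {Γ₁ Γ₂ : Theory α} (H : StrongEquiv Γ₁ Γ₂) {X Y : Set α} (h : X ⊆ Y)
    (h1 : htSatT X Y Γ₁) : htSatT X Y Γ₂ := by
  have hY1 := persT h _ h1
  have hY2 : htSatT Y Y Γ₂ := by
    have := H (atoms Y) Y
    rw [ans_atoms _ subset_rfl, ans_atoms _ subset_rfl] at this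
    exact (this.1 ⟨hY1, fun X' a b => absurd a b.2⟩).1
  by_contra h2
  have hne : X ≠ Y := by rintro rfl; exact h2 hY2
  let Δ : Theory α := atoms X ∪
    {φ | ∃ a ∈ Y \ X, ∃ b ∈ Y \ X, φ = PForm.impl (PForm.atom a) (PForm.atom b)}
  have hΔ : ∀ Z, Z ⊆ Y → (htSatT Z Y Δ ↔ (Z = X ∨ Z = Y)) := by
    intro Z hZ
    rw [unionT, atomsT]
    constructor
    · rintro ⟨k1, k2⟩
      by_cases e : Z ⊆ X
      · exact Or.inl (e.antisymm k1)
      · obtain ⟨a, ha, hax⟩ := Set.not_subset.1 e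
        refine Or.inr (hZ.antisymm fun b hb => ?_)
        by_cases hbx : b ∈ X
        · exact k1 hbx
        · exact (k2 _ ⟨a, ⟨hZ ha, hax⟩, b, ⟨hb, hbx⟩, rfl⟩).1 ha
    · intro k
      refine ⟨by rcases k with rfl | rfl; exacts [subset_rfl, h], ?_⟩
      rintro _ ⟨a, ha, b, hb, rfl⟩
      refine ⟨fun q => ?_, fun _ => hb.1⟩
      rcases k with rfl | rfl
      · exact absurd q ha.2
      · exact hb.1
  have A2 : IsAnswerSet (Γ₂ ∪ Δ) Y := by
    refine ⟨(unionT _ _ _ _).2 ⟨hY2, (hΔ Y subset_rfl).2 (Or.inr rfl)⟩, fun Z hZ k => ?_⟩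
    rw [unionT, hΔ Z hZ.subset] at k
    rcases k with ⟨k, rfl | rfl⟩
    · exact h2 k
    · exact hZ.ne rfl
  exact ((H Δ Y).2 A2).2 X (h.ssubset_of_ne hne)
    ((unionT _ _ _ _).2 ⟨h1, (hΔ X h).2 (Or.inl rfl)⟩)

theorem strong_iff (Γ₁ Γ₂ : Theory α) :
    StrongEquiv Γ₁ Γ₂ ↔ ∀ X Y : Set α, X ⊆ Y → (htSatT X Y Γ₁ ↔ htSatT X Y Γ₂) := by
  constructor
  · exact fun H X Y h => ⟨strong_aux H h, strong_aux (fun Δ Y => (H Δ Y).symm) h⟩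
  · intro H Δ Y
    simp only [IsAnswerSet, unionT]
    rw [H Y Y subset_rfl]
    refine and_congr_right fun _ => forall₂_congr fun X h => ?_
    rw [H X Y h.subset]

theorem es_iff (Γ : Theory α) (X Y : Set α) : (X, Y) ∈ Es Γ ↔
    X ⊆ Y ∧ htSatT Y Y Γ ∧ (X = Y ∨ ¬ htSatT X Y Γ) := by
  simp only [Es, Set.mem_ofPred_eq, ← totT]
  refine and_congr_right fun _ => ⟨?_, ?_⟩
  · rintro (⟨rfl, k⟩ | ⟨k, l⟩)
    · exact ⟨k, Or.inl rfl⟩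
    · exact ⟨l, Or.inr k⟩
  · rintro ⟨k, rfl | l⟩
    · exact Or.inl ⟨rfl, k⟩
    · exact Or.inr ⟨l, k⟩

theorem set_eq (S T : Set (Set α × Set α)) : S = T ↔ ∀ X Y, (X, Y) ∈ S ↔ (X, Y) ∈ T := by
  rw [Set.ext_iff, Prod.forall]

end HTAux

open HTAux in
/-- For each e ∈ {c,a,s,u}, the propositions Γ₁ ≡ₑ Γ₂, C_e(Γ₁)=C_e(Γ₂),
and E_e(Γ₁)=E_e(Γ₂) are equivalent. -/
theorem equivalences_characterized_by_countermodels_and_equivalence_interpretations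
    (Γ₁ Γ₂ : Theory α) :
    ((ClassEquiv Γ₁ Γ₂ ↔ Cc Γ₁ = Cc Γ₂) ∧ (ClassEquiv Γ₁ Γ₂ ↔ Ec Γ₁ = Ec Γ₂)) ∧
    ((AnswerEquiv Γ₁ Γ₂ ↔ Ca Γ₁ = Ca Γ₂) ∧ (AnswerEquiv Γ₁ Γ₂ ↔ Ea Γ₁ = Ea Γ₂)) ∧
    ((StrongEquiv Γ₁ Γ₂ ↔ Cs Γ₁ = Cs Γ₂) ∧ (StrongEquiv Γ₁ Γ₂ ↔ Es Γ₁ = Es Γ₂)) ∧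
    ((UnifEquiv Γ₁ Γ₂ ↔ Cu Γ₁ = Cu Γ₂) ∧ (UnifEquiv Γ₁ Γ₂ ↔ Eu Γ₁ = Eu Γ₂)) := by
  refine ⟨⟨?_, ?_⟩, ⟨?_, ?_⟩, ⟨?_, ?_⟩, ⟨?_, ?_⟩⟩
  · simp only [set_eq, Cc, Cs, Set.mem_ofPred_eq, ClassEquiv, ← totT]
    constructor
    · intro H X Y
      refine and_congr_left fun e => ?_
      subst e
      rw [H X]
    · intro H Y
      have := H Y Y
      simp only [subset_rfl, true_and, and_true] at this
      exact not_iff_not.1 this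
  · simp only [set_eq, Ec, Set.mem_sep_iff, es_iff, ClassEquiv, ← totT]
    constructor
    · intro H X Y
      rw [H Y]
      refine and_congr_left fun e => ?_
      subst e
      simp
    · intro H Y
      simpa using H Y Y
  · simp only [set_eq, Ca, Set.mem_ofPred_eq, AnswerEquiv, there_iff, ans_iff]
    constructor
    · intro H X Y
      refine and_congr_right fun e => ?_
      subst e
      exact H Y
    · intro H Y
      simpa using H ∅ Y
  · have key : ∀ (Γ : Theory α) (Y : Set α),
        (∀ X, X ⊆ Y → (X, Y) ∈ Es Γ) ↔ U Γ ∅ Y := fun Γ Y => by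
      rw [← closed_iff Γ (Set.empty_subset Y)]
      simp [ClosedIn]
    simp only [set_eq, Ea, Set.mem_ofPred_eq, AnswerEquiv, key, ans_iff]
    constructor
    · intro H X Y
      rw [H Y]
    · intro H Y
      simpa using H Y Y
  · simp only [strong_iff, set_eq, Cs, Set.mem_ofPred_eq]
    refine forall₂_congr fun X Y => ?_
    rw [and_congr_right_iff, not_iff_not]
  · simp only [strong_iff, set_eq, es_iff]
    constructor
    · intro H X Y
      refine and_congr_right fun h => ?_
      rw [H X Y h, H Y Y subset_rfl]
    · intro H X Y h
      have a := H Y Y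
      have b := H X Y
      simp only [subset_rfl, true_and, true_or, and_true] at a
      by_cases e : X = Y
      · subst e; exact a
      · simp only [h, true_and, e, false_or] at b
        have p1 := persT h Γ₁
        have p2 := persT h Γ₂
        tauto
  · simp only [unif_iff, set_eq, Cu, Set.mem_ofPred_eq, there_iff]
    refine forall₂_congr fun X Y => ?_
    rw [and_congr_right_iff]
  · simp only [unif_iff, set_eq, Eu, Set.mem_ofPred_eq]
    refine forall₂_congr fun X Y => ?_
    rw [and_congr_right_iff]
    refine forall_congr' fun h => ?_
    rw [closed_iff _ h, closed_iff _ h]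
end

section
/- Let Γ be a propositional theory over L, let L' ⊃ L, and let M be an HT-interpretation over L' such that the restriction M|_L is totality preserving. Then M ∈ C_s(Γ) implies M|_L ∈ C_s(Γ), i.e., if M is an HT-countermodel of Γ then so is its restriction to L. -/
variable {α : Type}

theorem clSat_inter_iff (L Y : Set α) (φ : PForm α) (h : PForm.atomsIn L φ) :
    PForm.clSat (Y ∩ L) φ ↔ PForm.clSat Y φ := by
  induction φ with
  | atom a => exact ⟨fun k => k.1, fun k => ⟨k, h⟩⟩
  | bot => exact Iff.rfl
  | conj φ ψ ih1 ih2 => exact and_congr (ih1 h.1) (ih2 h.2)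
  | disj φ ψ ih1 ih2 => exact or_congr (ih1 h.1) (ih2 h.2)
  | impl φ ψ ih1 ih2 => exact imp_congr (ih1 h.1) (ih2 h.2)

theorem htSat_inter_iff (L X Y : Set α) (φ : PForm α) (h : PForm.atomsIn L φ) :
    PForm.htSat (X ∩ L) (Y ∩ L) φ ↔ PForm.htSat X Y φ := by
  induction φ with
  | atom a => exact ⟨fun k => k.1, fun k => ⟨k, h⟩⟩
  | bot => exact Iff.rfl
  | conj φ ψ ih1 ih2 => exact and_congr (ih1 h.1) (ih2 h.2)
  | disj φ ψ ih1 ih2 => exact or_congr (ih1 h.1) (ih2 h.2)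
  | impl φ ψ ih1 ih2 =>
    exact and_congr (imp_congr (ih1 h.1) (ih2 h.2))
      (imp_congr (clSat_inter_iff L Y φ h.1) (clSat_inter_iff L Y ψ h.2))

/-- If Γ is a theory over L, L ⊂ L', M = (X,Y) is an HT-interpretation
over L' whose restriction to L is totality preserving, then M ∈ C_s(Γ) implies
M|_L ∈ C_s(Γ). -/
theorem countermodel_restriction (L L' : Set α) (hLL' : L ⊂ L') (Γ : Theory α)
    (hΓ : ∀ φ ∈ Γ, PForm.atomsIn L φ) (X Y : Set α) (hXY : X ⊆ Y) (hYL' : Y ⊆ L')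
    (htp : X ⊂ Y → X ∩ L ⊂ Y ∩ L) :
    (X, Y) ∈ Cs Γ → (X ∩ L, Y ∩ L) ∈ Cs Γ := by
  rintro ⟨_, h⟩
  exact ⟨Set.inter_subset_inter_left L hXY,
    fun k => h fun φ hφ => (htSat_inter_iff L X Y φ (hΓ φ hφ)).1 (k φ hφ)⟩
end

section
/- Let Γ be an extended propositional A⁺-A⁻-theory and (X,Y) an HT-interpretation. If (X,Y) ⊨ Γ, then (X',Y) ⊨ Γ for all X' ⊆ Y such that X ∩ A⁺ ⊆ X' ∩ A⁺ and X' ∩ A⁻ ⊆ X ∩ A⁻. -/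
variable {α : Type}

/-- Polarity-correct occurrence of atoms: `APol Ap An true φ` states that the formula φ,
itself occurring positively, has all its positively occurring atoms in `Ap` and all its
negatively occurring atoms in `An` (atoms in antecedents of implications occur negatively,
atoms in consequents occur positively; in a negatively occurring implication — e.g. the
antecedent φ₁ of (φ₁→φ₂)→φ₃ — both components additionally occur with both polarities). -/
def APol (Ap An : Set α) : Bool → PForm α → Prop
  | p, .atom a => if p then a ∈ Ap else a ∈ An
  | _, .bot => True
  | p, .conj φ ψ => APol Ap An p φ ∧ APol Ap An p ψ
  | p, .disj φ ψ => APol Ap An p φ ∧ APol Ap An p ψ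
  | true, .impl φ ψ => APol Ap An false φ ∧ APol Ap An true ψ
  | false, .impl φ ψ =>
      (APol Ap An false φ ∧ APol Ap An true φ) ∧ (APol Ap An true ψ ∧ APol Ap An false ψ)

/-- An A⁺-A⁻-theory. -/
def IsAATheory (Ap An : Set α) (Γ : Theory α) : Prop :=
  ∀ φ ∈ Γ, APol Ap An true φ

/-- An extended A⁺-A⁻-theory: additionally factual formulas over A⁺ are permitted. -/
def IsExtAATheory (Ap An : Set α) (Γ : Theory α) : Prop :=
  ∀ φ ∈ Γ, APol Ap An true φ ∨ (PForm.Factual φ ∧ PForm.atomsIn Ap φ)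

/-- Relativized hyperequivalence wrt A⁺ and A⁻. -/
def HyperEquiv (Ap An : Set α) (Γ₁ Γ₂ : Theory α) : Prop :=
  ∀ Γ : Theory α, IsAATheory Ap An Γ → AnswerEquiv (Γ₁ ∪ Γ) (Γ₂ ∪ Γ)

/-- (Y,Y) is A⁺-total: (Y ∩ A⁺, Y) is closed in E_s(Γ). -/
def ApTotal (Ap : Set α) (Γ : Theory α) (Y : Set α) : Prop :=
  ∀ X', Y ∩ Ap ⊆ X' → X' ⊆ Y → (X', Y) ∈ Es Γ

/-- (X,Y) is A⁺-closed in E_s(Γ). -/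
def ApClosed (Ap An : Set α) (Γ : Theory α) (X Y : Set α) : Prop :=
  ∀ X', X' ⊆ Y → X ∩ Ap ⊆ X' ∩ Ap → X' ∩ An ⊆ X ∩ An → (X', Y) ∈ Es Γ

/-- E^{A⁺}_{A⁻}(Γ): the HT-hyperequivalence interpretations of Γ wrt A⁺ and A⁻. -/
def Eh (Ap An : Set α) (Γ : Theory α) : Set (Set α × Set α) :=
  {p | p.1 ⊆ p.2 ∧ ApTotal Ap Γ p.2 ∧
    ∃ X', X' ⊆ p.2 ∧ p.1 = X' ∩ (Ap ∪ An) ∧ ApClosed Ap An Γ X' p.2}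

theorem aux_pol (Ap An X Y X' : Set α) (hp : X ∩ Ap ⊆ X' ∩ Ap) (hn : X' ∩ An ⊆ X ∩ An)
    (φ : PForm α) :
    (APol Ap An true φ → PForm.htSat X Y φ → PForm.htSat X' Y φ) ∧
    (APol Ap An false φ → PForm.htSat X' Y φ → PForm.htSat X Y φ) := by
  induction φ with
  | atom a =>
    simp only [APol, PForm.htSat]
    exact ⟨fun h hx => (hp ⟨hx, by simpa using h⟩).1, fun h hx => (hn ⟨hx, by simpa using h⟩).1⟩
  | bot => simp [PForm.htSat]
  | conj φ ψ h1 h2 => simp only [APol, PForm.htSat]; tauto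
  | disj φ ψ h1 h2 => simp only [APol, PForm.htSat]; tauto
  | impl φ ψ h1 h2 => simp only [APol, PForm.htSat]; tauto

theorem aux_fact (Ap X Y X' : Set α) (hX' : X' ⊆ Y) (hp : X ∩ Ap ⊆ X' ∩ Ap)
    (φ : PForm α) : PForm.Factual φ → PForm.atomsIn Ap φ →
    PForm.htSat X Y φ → PForm.htSat X' Y φ := by
  induction φ with
  | atom a => exact fun _ ha hx => (hp ⟨hx, ha⟩).1
  | bot => exact fun _ _ => id
  | conj φ ψ h1 h2 => exact fun f a h => ⟨h1 f.1 a.1 h.1, h2 f.2 a.2 h.2⟩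
  | disj φ ψ h1 h2 => exact fun f a h => h.imp (h1 f.1 a.1) (h2 f.2 a.2)
  | impl φ ψ h1 h2 =>
    rintro ⟨_, rfl⟩ _ h
    exact ⟨fun hx => h.2 (aux_pers X' Y hX' φ hx), h.2⟩

/-- For an extended A⁺-A⁻-theory Γ, if (X,Y) ⊨ Γ then (X',Y) ⊨ Γ for all
X' ⊆ Y with X ∩ A⁺ ⊆ X' ∩ A⁺ and X' ∩ A⁻ ⊆ X ∩ A⁻. -/
theorem ext_AA_theory_monotone (Ap An : Set α) (Γ : Theory α)
    (hΓ : IsExtAATheory Ap An Γ) (X Y : Set α) (hXY : X ⊆ Y)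
    (hsat : htSatT X Y Γ) (X' : Set α) (hX'Y : X' ⊆ Y)
    (hp : X ∩ Ap ⊆ X' ∩ Ap) (hn : X' ∩ An ⊆ X ∩ An) :
    htSatT X' Y Γ := by
  intro φ hφ
  rcases hΓ φ hφ with h | ⟨h1, h2⟩
  · exact (aux_pol Ap An X Y X' hp hn φ).1 h (hsat φ hφ)
  · exact aux_fact Ap X Y X' hX'Y hp φ h1 h2 (hsat φ hφ)
end

section
/- Given two propositional disjunctive logic programs Π1 and Π2 and sets of propositional variables A⁺ and A⁻: Π1 and Π2 are relativized hyperequivalent wrt. A⁺ and A⁻ in the logic programming sense (Π1 ∪ Π answer-set equivalent to Π2 ∪ Π for every program Π all of whose rules r satisfy H⁻(r) = ∅, H⁺(r) ⊆ A⁺ and all body atoms in A⁻) if and only if Π1 and Π2, viewed as propositional theories, are relativized hyperequivalent wrt. A⁺ and A⁻ (i.e., Π1 ∪ Γ and Π2 ∪ Γ are answer-set equivalent for every A⁺-A⁻-theory Γ). -/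
variable {α : Type}

/-- A disjunctive rule a₁∨…∨a_k ∨ ¬a_{k+1}∨…∨¬a_l ← b₁,…,b_m, ¬b_{m+1},…,¬b_n
(with l + n > 0). -/
structure Rule (α : Type) : Type where
  headPos : List α
  headNeg : List α
  bodyPos : List α
  bodyNeg : List α
  nontrivial :
    headPos.length + headNeg.length + bodyPos.length + bodyNeg.length > 0

/-- ¬φ. -/
def pneg (φ : PForm α) : PForm α := PForm.impl φ PForm.bot

def bigConj (l : List (PForm α)) : PForm α :=
  l.foldr PForm.conj (PForm.impl PForm.bot PForm.bot)

def bigDisj (l : List (PForm α)) : PForm α := l.foldr PForm.disj PForm.bot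

/-- The formula corresponding to a rule: body → head. -/
def Rule.form (r : Rule α) : PForm α :=
  PForm.impl
    (bigConj (r.bodyPos.map PForm.atom ++ r.bodyNeg.map (fun b => pneg (PForm.atom b))))
    (bigDisj (r.headPos.map PForm.atom ++ r.headNeg.map (fun a => pneg (PForm.atom a))))

/-- The propositional theory corresponding to a program (set of rules). -/
def progThy (P : Set (Rule α)) : Theory α := Rule.form '' P

/-- A context program for relativized hyperequivalence in the logic-programming sense:
rules r with H⁻(r) = ∅, H⁺(r) ⊆ A⁺ and all body atoms in A⁻. -/
def LPContext (Ap An : Set α) (P : Set (Rule α)) : Prop :=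
  ∀ r ∈ P, r.headNeg = [] ∧ (∀ a ∈ r.headPos, a ∈ Ap) ∧
    (∀ b ∈ r.bodyPos, b ∈ An) ∧ (∀ b ∈ r.bodyNeg, b ∈ An)

def PForm.ats : PForm α → List α
  | .atom a => [a]
  | .bot => []
  | .conj φ ψ => PForm.ats φ ++ PForm.ats ψ
  | .disj φ ψ => PForm.ats φ ++ PForm.ats ψ
  | .impl φ ψ => PForm.ats φ ++ PForm.ats ψ

theorem ht_mono (Ap An X X' Y : Set α) (φ : PForm α)
    (h1 : ∀ a ∈ φ.ats, a ∈ Ap → a ∈ X → a ∈ X')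
    (h2 : ∀ a ∈ φ.ats, a ∈ An → a ∈ X' → a ∈ X) :
    (APol Ap An true φ → PForm.htSat X Y φ → PForm.htSat X' Y φ) ∧
    (APol Ap An false φ → PForm.htSat X' Y φ → PForm.htSat X Y φ) := by
  induction φ with
  | atom a => simp_all [PForm.ats, APol, PForm.htSat]
  | bot => simp [PForm.htSat]
  | conj φ ψ ih1 ih2 =>
    simp only [PForm.ats, List.mem_append] at h1 h2
    have i1 := ih1 (fun a h => h1 a (Or.inl h)) (fun a h => h2 a (Or.inl h))
    have i2 := ih2 (fun a h => h1 a (Or.inr h)) (fun a h => h2 a (Or.inr h))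
    simp only [APol, PForm.htSat]
    exact ⟨fun p h => ⟨i1.1 p.1 h.1, i2.1 p.2 h.2⟩, fun p h => ⟨i1.2 p.1 h.1, i2.2 p.2 h.2⟩⟩
  | disj φ ψ ih1 ih2 =>
    simp only [PForm.ats, List.mem_append] at h1 h2
    have i1 := ih1 (fun a h => h1 a (Or.inl h)) (fun a h => h2 a (Or.inl h))
    have i2 := ih2 (fun a h => h1 a (Or.inr h)) (fun a h => h2 a (Or.inr h))
    simp only [APol, PForm.htSat]
    exact ⟨fun p h => h.imp (i1.1 p.1) (i2.1 p.2), fun p h => h.imp (i1.2 p.1) (i2.2 p.2)⟩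
  | impl φ ψ ih1 ih2 =>
    simp only [PForm.ats, List.mem_append] at h1 h2
    have i1 := ih1 (fun a h => h1 a (Or.inl h)) (fun a h => h2 a (Or.inl h))
    have i2 := ih2 (fun a h => h1 a (Or.inr h)) (fun a h => h2 a (Or.inr h))
    simp only [APol, PForm.htSat]
    constructor
    · rintro ⟨p1, p2⟩ ⟨h, hc⟩
      exact ⟨fun h' => i2.1 p2 (h (i1.2 p1 h')), hc⟩
    · rintro ⟨⟨p1, p2⟩, p3, p4⟩ ⟨h, hc⟩
      exact ⟨fun h' => i2.2 p4 (h (i1.1 p2 h')), hc⟩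

theorem ht_bigConj (X Y : Set α) (l : List (PForm α)) :
    PForm.htSat X Y (bigConj l) ↔ ∀ φ ∈ l, PForm.htSat X Y φ := by
  induction l with
  | nil => simp [bigConj, PForm.htSat]
  | cons a l ih => simp only [bigConj] at ih; simp [bigConj, PForm.htSat, ih]

theorem cl_bigConj (Y : Set α) (l : List (PForm α)) :
    PForm.clSat Y (bigConj l) ↔ ∀ φ ∈ l, PForm.clSat Y φ := by
  induction l with
  | nil => simp [bigConj, PForm.clSat]
  | cons a l ih => simp only [bigConj] at ih; simp [bigConj, PForm.clSat, ih]

theorem ht_bigDisj (X Y : Set α) (l : List (PForm α)) :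
    PForm.htSat X Y (bigDisj l) ↔ ∃ φ ∈ l, PForm.htSat X Y φ := by
  induction l with
  | nil => simp [bigDisj, PForm.htSat]
  | cons a l ih => simp only [bigDisj] at ih; simp [bigDisj, PForm.htSat, ih]

theorem cl_bigDisj (Y : Set α) (l : List (PForm α)) :
    PForm.clSat Y (bigDisj l) ↔ ∃ φ ∈ l, PForm.clSat Y φ := by
  induction l with
  | nil => simp [bigDisj, PForm.clSat]
  | cons a l ih => simp only [bigDisj] at ih; simp [bigDisj, PForm.clSat, ih]

theorem pol_bigConj (Ap An : Set α) (l : List α) (h : ∀ a ∈ l, a ∈ An) :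
    APol Ap An false (bigConj (l.map PForm.atom)) := by
  induction l with
  | nil => simp [bigConj, APol]
  | cons a l ih =>
    simp only [bigConj] at ih
    simp only [List.mem_cons, forall_eq_or_imp] at h
    simp [bigConj, APol, ih h.2, h.1]

theorem pol_bigDisj (Ap An : Set α) (l : List α) (h : ∀ a ∈ l, a ∈ Ap) :
    APol Ap An true (bigDisj (l.map PForm.atom)) := by
  induction l with
  | nil => simp [bigDisj, APol]
  | cons a l ih =>
    simp only [bigDisj] at ih
    simp only [List.mem_cons, forall_eq_or_imp] at h
    simp [bigDisj, APol, ih h.2, h.1]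

/-- The positive rule formula. -/
def posRule (B H : List α) : PForm α :=
  PForm.impl (bigConj (B.map PForm.atom)) (bigDisj (H.map PForm.atom))

theorem ht_posRule (X Y : Set α) (B H : List α) :
    PForm.htSat X Y (posRule B H) ↔
      ((∀ b ∈ B, b ∈ X) → ∃ a ∈ H, a ∈ X) ∧ ((∀ b ∈ B, b ∈ Y) → ∃ a ∈ H, a ∈ Y) := by
  simp [posRule, PForm.htSat, PForm.clSat, ht_bigConj, cl_bigConj, ht_bigDisj, cl_bigDisj]

theorem ht_rule (X Y : Set α) (hXY : X ⊆ Y) (r : Rule α) (hr : r.headNeg = []) :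
    PForm.htSat X Y r.form ↔
      ((∀ b ∈ r.bodyNeg, b ∉ Y) → PForm.htSat X Y (posRule r.bodyPos r.headPos)) := by
  rw [ht_posRule]
  simp only [Rule.form, hr, PForm.htSat, ht_bigConj, cl_bigConj, ht_bigDisj, cl_bigDisj,
    List.mem_append, List.mem_map, pneg]
  have e1 : (∀ φ, ((∃ a ∈ r.bodyPos, PForm.atom a = φ) ∨
      ∃ a ∈ r.bodyNeg, (PForm.atom a).impl PForm.bot = φ) → PForm.htSat X Y φ) ↔
      (∀ b ∈ r.bodyPos, b ∈ X) ∧ (∀ b ∈ r.bodyNeg, b ∉ Y) := by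
    constructor
    · intro h
      exact ⟨fun b hb => h _ (Or.inl ⟨b, hb, rfl⟩),
        fun b hb hY => (h _ (Or.inr ⟨b, hb, rfl⟩)).2 hY⟩
    · rintro ⟨h1, h2⟩ φ (⟨b, hb, rfl⟩ | ⟨b, hb, rfl⟩)
      · exact h1 b hb
      · exact ⟨fun h => h2 b hb (hXY h), fun h => h2 b hb h⟩
  have e2 : (∀ φ, ((∃ a ∈ r.bodyPos, PForm.atom a = φ) ∨
      ∃ a ∈ r.bodyNeg, (PForm.atom a).impl PForm.bot = φ) → PForm.clSat Y φ) ↔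
      (∀ b ∈ r.bodyPos, b ∈ Y) ∧ (∀ b ∈ r.bodyNeg, b ∉ Y) := by
    constructor
    · intro h
      exact ⟨fun b hb => h _ (Or.inl ⟨b, hb, rfl⟩),
        fun b hb hY => h _ (Or.inr ⟨b, hb, rfl⟩) hY⟩
    · rintro ⟨h1, h2⟩ φ (⟨b, hb, rfl⟩ | ⟨b, hb, rfl⟩)
      · exact h1 b hb
      · exact fun h => h2 b hb h
  rw [e1, e2]
  simp only [List.not_mem_nil, false_and, exists_false, or_false, exists_exists_and_eq_and,
    PForm.htSat, PForm.clSat]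
  tauto

theorem htSatT_union (X Y : Set α) (S T : Theory α) :
    htSatT X Y (S ∪ T) ↔ htSatT X Y S ∧ htSatT X Y T := by
  simp only [htSatT, Set.mem_union]
  constructor
  · exact fun h => ⟨fun φ hφ => h φ (Or.inl hφ), fun φ hφ => h φ (Or.inr hφ)⟩
  · rintro ⟨h1, h2⟩ φ (h | h)
    · exact h1 φ h
    · exact h2 φ h

theorem as_congr (Y : Set α) (T S S' : Theory α)
    (h : ∀ X, X ⊆ Y → (htSatT X Y S ↔ htSatT X Y S')) :
    IsAnswerSet (T ∪ S) Y ↔ IsAnswerSet (T ∪ S') Y := by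
  unfold IsAnswerSet
  simp only [htSatT_union]
  rw [h Y subset_rfl]
  refine and_congr Iff.rfl (forall_congr' fun X => forall_congr' fun hX => ?_)
  rw [h X hX.1]

theorem lp_hyperequivalence_iff_theory_hyperequivalence
    (Ap An : Set α) (P₁ P₂ : Set (Rule α)) :
    (∀ P : Set (Rule α), LPContext Ap An P →
       AnswerEquiv (progThy P₁ ∪ progThy P) (progThy P₂ ∪ progThy P)) ↔
    HyperEquiv Ap An (progThy P₁) (progThy P₂) := by
  classical
  constructor
  · intro H Γ hΓ Y
    by_cases hY : htSatT Y Y Γ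
    swap
    · constructor <;> intro h <;> exact absurd ((htSatT_union _ _ _ _).1 h.1).2 hY
    let P : Set (Rule α) := {r | (r.headNeg = [] ∧ (∀ a ∈ r.headPos, a ∈ Ap) ∧
      (∀ b ∈ r.bodyPos, b ∈ An) ∧ (∀ b ∈ r.bodyNeg, b ∈ An)) ∧
      ∀ X, X ⊆ Y → htSatT X Y Γ → PForm.htSat X Y r.form}
    have key : ∀ X, X ⊆ Y → (htSatT X Y Γ ↔ htSatT X Y (progThy P)) := by
      intro X hX
      constructor
      · rintro h _ ⟨r, hr, rfl⟩
        exact hr.2 X hX h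
      · intro h φ hφ
        by_contra hn
        let B := φ.ats.filter (fun a => a ∈ X ∧ a ∈ An)
        let Hd := φ.ats.filter (fun a => a ∈ Ap ∧ a ∉ X)
        have main : ∀ X', PForm.htSat X' Y φ → (∀ b ∈ B, b ∈ X') → ∃ a ∈ Hd, a ∈ X' := by
          intro X' hX' hB
          by_contra hc
          push Not at hc
          refine hn ((ht_mono Ap An X' X Y φ ?_ ?_).1 (hΓ φ hφ) hX')
          · intro a ha hp hx
            by_contra hax
            exact hc a (by simp [Hd, ha, hp, hax]) hx
          · intro a ha hp hx
            exact hB a (by simp [B, ha, hp, hx])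
        have hBY : ∀ b ∈ B, b ∈ Y := by
          intro b hb
          simp only [B, List.mem_filter, decide_eq_true_eq] at hb
          exact hX hb.2.1
        obtain ⟨a, ha, -⟩ := main Y (hY φ hφ) hBY
        have hpos : Hd.length > 0 := List.length_pos_of_mem ha
        let r : Rule α := ⟨Hd, [], B, [], by omega⟩
        have hr : r ∈ P := by
          refine ⟨⟨rfl, ?_, ?_, ?_⟩, ?_⟩
          · intro a ha
            simp only [r, Hd, List.mem_filter, decide_eq_true_eq] at ha
            exact ha.2.1
          · intro a ha
            simp only [r, B, List.mem_filter, decide_eq_true_eq] at ha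
            exact ha.2.2
          · intro a ha
            simp [r] at ha
          · intro X' hX' hs
            rw [ht_rule X' Y hX' r rfl, ht_posRule]
            intro _
            exact ⟨main X' (hs φ hφ), main Y (hY φ hφ)⟩
        have h' := h _ ⟨r, hr, rfl⟩
        rw [ht_rule X Y hX r rfl, ht_posRule] at h'
        obtain ⟨a, ha, hax⟩ := (h' (by simp [r])).1 (by
          intro b hb
          simp only [r, B, List.mem_filter, decide_eq_true_eq] at hb
          exact hb.2.1)
        simp only [r, Hd, List.mem_filter, decide_eq_true_eq] at ha
        exact ha.2.2 hax
    rw [as_congr Y _ _ _ key, as_congr Y _ _ _ key]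
    exact H P (fun r hr => hr.1) Y
  · intro H P hP Y
    let Γ : Theory α := {φ | ∃ r ∈ P, (∀ b ∈ r.bodyNeg, b ∉ Y) ∧ φ = posRule r.bodyPos r.headPos}
    have key : ∀ X, X ⊆ Y → (htSatT X Y (progThy P) ↔ htSatT X Y Γ) := by
      intro X hX
      constructor
      · rintro h _ ⟨r, hr, hb, rfl⟩
        exact (ht_rule X Y hX r (hP r hr).1).1 (h _ ⟨r, hr, rfl⟩) hb
      · rintro h _ ⟨r, hr, rfl⟩
        exact (ht_rule X Y hX r (hP r hr).1).2 (fun hb => h _ ⟨r, hr, hb, rfl⟩)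
    rw [as_congr Y _ _ _ key, as_congr Y _ _ _ key]
    refine H Γ ?_ Y
    rintro _ ⟨r, hr, hb, rfl⟩
    exact ⟨pol_bigConj Ap An _ (hP r hr).2.2.1, pol_bigDisj Ap An _ (hP r hr).2.1⟩
end

section
/- Let φ be a factual first-order sentence. If ⟨I,J,K⟩ ⊨ φ (QHT-satisfaction) and J ⊆ J' ⊆ K, then ⟨I,J',K⟩ ⊨ φ. -/
/-- A first-order signature: function symbols and predicate symbols with arities. -/
structure Sig : Type 1 where
  Func : Type
  arF : Func → ℕ
  Pred : Type
  arP : Pred → ℕ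

/-- Terms over a signature, with variables represented by de Bruijn indices. -/
inductive Tm (σ : Sig) : Type where
  | var : ℕ → Tm σ
  | func : (f : σ.Func) → (Fin (σ.arF f) → Tm σ) → Tm σ

/-- First-order formulas (with equality) over a signature; quantifiers use
de Bruijn indices. -/
inductive Fm (σ : Sig) : Type where
  | atom : (p : σ.Pred) → (Fin (σ.arP p) → Tm σ) → Fm σ
  | eq : Tm σ → Tm σ → Fm σ
  | bot : Fm σ
  | conj : Fm σ → Fm σ → Fm σ
  | disj : Fm σ → Fm σ → Fm σ
  | impl : Fm σ → Fm σ → Fm σ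
  | all : Fm σ → Fm σ
  | ex : Fm σ → Fm σ

variable {σ : Sig}

/-- An interpretation of the function symbols of σ on a universe U. -/
abbrev Interp (σ : Sig) (U : Type) := ∀ f : σ.Func, (Fin (σ.arF f) → U) → U

/-- Ground atoms over the universe U: the set At(P, C_U) of atomic formulas
built from predicates and names of elements of U. -/
def GAtom (σ : Sig) (U : Type) : Type := Σ p : σ.Pred, Fin (σ.arP p) → U

/-- Value of a term under interpretation I and environment env. -/
def tval {U : Type} (I : Interp σ U) (env : ℕ → U) : Tm σ → U
  | .var n => env n
  | .func f ts => I f (fun i => tval I env (ts i))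

/-- Push a value onto an environment (for quantifiers). -/
def push {U : Type} (d : U) (env : ℕ → U) : ℕ → U
  | 0 => d
  | n + 1 => env n

/-- Classical (there-world) satisfaction by ⟨I,K⟩. -/
def clFoSat {U : Type} (I : Interp σ U) (K : Set (GAtom σ U)) (env : ℕ → U) : Fm σ → Prop
  | .atom p ts => (⟨p, fun i => tval I env (ts i)⟩ : GAtom σ U) ∈ K
  | .eq t₁ t₂ => tval I env t₁ = tval I env t₂
  | .bot => False
  | .conj φ ψ => clFoSat I K env φ ∧ clFoSat I K env ψ
  | .disj φ ψ => clFoSat I K env φ ∨ clFoSat I K env ψ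
  | .impl φ ψ => clFoSat I K env φ → clFoSat I K env ψ
  | .all φ => ∀ d : U, clFoSat I K (push d env) φ
  | .ex φ => ∃ d : U, clFoSat I K (push d env) φ

/-- QHT-satisfaction by the QHT-interpretation ⟨I,J,K⟩. -/
def qhtSat {U : Type} (I : Interp σ U) (J K : Set (GAtom σ U)) (env : ℕ → U) :
    Fm σ → Prop
  | .atom p ts => (⟨p, fun i => tval I env (ts i)⟩ : GAtom σ U) ∈ J
  | .eq t₁ t₂ => tval I env t₁ = tval I env t₂
  | .bot => False
  | .conj φ ψ => qhtSat I J K env φ ∧ qhtSat I J K env ψ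
  | .disj φ ψ => qhtSat I J K env φ ∨ qhtSat I J K env ψ
  | .impl φ ψ => (qhtSat I J K env φ → qhtSat I J K env ψ) ∧
      (clFoSat I K env φ → clFoSat I K env ψ)
  | .all φ => ∀ d : U, qhtSat I J K (push d env) φ ∧ clFoSat I K (push d env) φ
  | .ex φ => ∃ d : U, qhtSat I J K (push d env) φ

/-- All variables of a term are < n. -/
def TmClosedUnder (n : ℕ) : Tm σ → Prop
  | .var m => m < n
  | .func _ ts => ∀ i, TmClosedUnder n (ts i)

/-- All free variables of a formula are < n. -/
def FmClosedUnder (n : ℕ) : Fm σ → Prop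
  | .atom _ ts => ∀ i, TmClosedUnder n (ts i)
  | .eq t₁ t₂ => TmClosedUnder n t₁ ∧ TmClosedUnder n t₂
  | .bot => True
  | .conj φ ψ => FmClosedUnder n φ ∧ FmClosedUnder n ψ
  | .disj φ ψ => FmClosedUnder n φ ∧ FmClosedUnder n ψ
  | .impl φ ψ => FmClosedUnder n φ ∧ FmClosedUnder n ψ
  | .all φ => FmClosedUnder (n + 1) φ
  | .ex φ => FmClosedUnder (n + 1) φ

/-- A sentence is a closed formula. -/
def Sentence (φ : Fm σ) : Prop := FmClosedUnder 0 φ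

/-- Factual sentences: built using ∧, ∨, ∃, ∀ and negations φ → ⊥ only. -/
def FoFactual : Fm σ → Prop
  | .atom _ _ => True
  | .eq _ _ => True
  | .bot => True
  | .conj φ ψ => FoFactual φ ∧ FoFactual ψ
  | .disj φ ψ => FoFactual φ ∧ FoFactual ψ
  | .impl φ ψ => FoFactual φ ∧ ψ = Fm.bot
  | .all φ => FoFactual φ
  | .ex φ => FoFactual φ

/-- ⟨I,J,K⟩ satisfies a first-order theory (set of sentences). -/
def QSatT {U : Type} (I : Interp σ U) (J K : Set (GAtom σ U)) (Γ : Set (Fm σ)) : Prop :=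
  ∀ φ ∈ Γ, ∀ env : ℕ → U, qhtSat I J K env φ

/-- ⟨I,K⟩ classically satisfies a first-order theory. -/
def ClSatT {U : Type} (I : Interp σ U) (K : Set (GAtom σ U)) (Γ : Set (Fm σ)) : Prop :=
  ∀ φ ∈ Γ, ∀ env : ℕ → U, clFoSat I K env φ

/-- ⟨I,K⟩ is an answer set of Γ: ⟨I,K,K⟩ is a quantified equilibrium model. -/
def FoAnswerSet {U : Type} (Γ : Set (Fm σ)) (I : Interp σ U) (K : Set (GAtom σ U)) :
    Prop :=
  QSatT I K K Γ ∧ ∀ J : Set (GAtom σ U), J ⊂ K → ¬ QSatT I J K Γ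

/-- ⟨I,J,K⟩ is there-closed in the set of QHT-countermodels of Γ. -/
def FoThereClosedCM {U : Type} (Γ : Set (Fm σ)) (I : Interp σ U)
    (J K : Set (GAtom σ U)) : Prop :=
  QSatT I K K Γ ∧ ∀ J', J ⊆ J' → J' ⊂ K → ¬ QSatT I J' K Γ

/-- ⟨I,J,K⟩ is a QHT equivalence-interpretation of Γ: a total QHT-model or a
QHT here-countermodel of Γ. -/
def FoEquivInterp {U : Type} (Γ : Set (Fm σ)) (I : Interp σ U)
    (J K : Set (GAtom σ U)) : Prop :=
  (J = K ∧ QSatT I J K Γ) ∨ (¬ QSatT I J K Γ ∧ ClSatT I K Γ)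

theorem qht_to_cl {σ : Sig} {U : Type} (I : Interp σ U)
    (J K : Set (GAtom σ U)) (hJK : J ⊆ K) (φ : Fm σ) :
    ∀ env : ℕ → U, qhtSat I J K env φ → clFoSat I K env φ := by
  induction φ with
  | atom p ts => intro env h; exact hJK h
  | eq a b => intro env h; exact h
  | bot => intro env h; exact h
  | conj a b iha ihb => intro env h; exact ⟨iha env h.1, ihb env h.2⟩
  | disj a b iha ihb => intro env h; exact Or.imp (iha env) (ihb env) h
  | impl a b iha ihb => intro env h; exact h.2
  | all a ih => intro env h; exact fun d => (h d).2
  | ex a ih => intro env h; obtain ⟨d, hd⟩ := h; exact ⟨d, ih _ hd⟩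

theorem factual_mono {σ : Sig} {U : Type} (I : Interp σ U)
    (J J' K : Set (GAtom σ U)) (hJJ' : J ⊆ J') (hJ'K : J' ⊆ K) (φ : Fm σ) :
    FoFactual φ → ∀ env : ℕ → U, qhtSat I J K env φ → qhtSat I J' K env φ := by
  induction φ with
  | atom p ts => intro _ env h; exact hJJ' h
  | eq a b => intro _ env h; exact h
  | bot => intro _ env h; exact h
  | conj a b iha ihb => intro f env h; exact ⟨iha f.1 env h.1, ihb f.2 env h.2⟩
  | disj a b iha ihb => intro f env h; exact Or.imp (iha f.1 env) (ihb f.2 env) h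
  | impl a b iha ihb =>
    intro f env h
    obtain ⟨_, rfl⟩ := f
    exact ⟨fun ha => h.2 (qht_to_cl I J' K hJ'K a env ha), h.2⟩
  | all a ih => intro f env h; exact fun d => ⟨ih f _ (h d).1, (h d).2⟩
  | ex a ih => intro f env h; obtain ⟨d, hd⟩ := h; exact ⟨d, ih f _ hd⟩

/-- If φ is a factual first-order sentence, ⟨I,J,K⟩ ⊨ φ and
J ⊆ J' ⊆ K, then ⟨I,J',K⟩ ⊨ φ. -/
theorem fo_factual_persistence {σ : Sig} {U : Type} [Nonempty U] (I : Interp σ U)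
    (J J' K : Set (GAtom σ U)) (hJK : J ⊆ K) (hJJ' : J ⊆ J') (hJ'K : J' ⊆ K)
    (φ : Fm σ) (hsen : Sentence φ) (hfac : FoFactual φ)
    (h : ∀ env : ℕ → U, qhtSat I J K env φ) :
    ∀ env : ℕ → U, qhtSat I J' K env φ := by
  exact fun env => factual_mono I J J' K hJJ' hJ'K φ hfac env (h env)
end

section
/- Let Γ be a first-order theory over a signature L, let L' ⊃ L, and let M be a QHT-interpretation over L' such that the restriction M|_L is totality preserving. Then M ∈ C_s(Γ) implies M|_L ∈ C_s(Γ), i.e., if M is a QHT-countermodel of Γ then so is its restriction to L. -/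
variable {σ : Sig}

variable {σ : Sig}

/-- A term uses only function symbols from Fs. -/
def TmOver (Fs : Set σ.Func) : Tm σ → Prop
  | .var _ => True
  | .func f ts => f ∈ Fs ∧ ∀ i, TmOver Fs (ts i)

/-- A formula is over the subsignature given by function symbols Fs and
predicate symbols Ps. -/
def FmOver (Fs : Set σ.Func) (Ps : Set σ.Pred) : Fm σ → Prop
  | .atom p ts => p ∈ Ps ∧ ∀ i, TmOver Fs (ts i)
  | .eq t₁ t₂ => TmOver Fs t₁ ∧ TmOver Fs t₂
  | .bot => True
  | .conj φ ψ => FmOver Fs Ps φ ∧ FmOver Fs Ps ψ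
  | .disj φ ψ => FmOver Fs Ps φ ∧ FmOver Fs Ps ψ
  | .impl φ ψ => FmOver Fs Ps φ ∧ FmOver Fs Ps ψ
  | .all φ => FmOver Fs Ps φ
  | .ex φ => FmOver Fs Ps φ

/-- Restriction of a set of ground atoms to the predicates of the subsignature. -/
def restrAt {U : Type} (Ps : Set σ.Pred) (J : Set (GAtom σ U)) : Set (GAtom σ U) :=
  {a ∈ J | a.1 ∈ Ps}

theorem clFoSat_restr {U : Type} (Fs : Set σ.Func) (Ps : Set σ.Pred) (I : Interp σ U)
    (K : Set (GAtom σ U)) (φ : Fm σ) : ∀ env : ℕ → U, FmOver Fs Ps φ →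
    (clFoSat I (restrAt Ps K) env φ ↔ clFoSat I K env φ) := by
  induction φ with
  | atom p ts => intro env h; exact ⟨fun h' => h'.1, fun h' => ⟨h', h.1⟩⟩
  | eq t₁ t₂ => intro env h; exact Iff.rfl
  | bot => intro env h; exact Iff.rfl
  | conj φ ψ ih1 ih2 => intro env h; exact and_congr (ih1 env h.1) (ih2 env h.2)
  | disj φ ψ ih1 ih2 => intro env h; exact or_congr (ih1 env h.1) (ih2 env h.2)
  | impl φ ψ ih1 ih2 => intro env h; exact imp_congr (ih1 env h.1) (ih2 env h.2)
  | all φ ih => intro env h; exact forall_congr' fun d => ih (push d env) h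
  | ex φ ih => intro env h; exact exists_congr fun d => ih (push d env) h

theorem qhtSat_restr {U : Type} (Fs : Set σ.Func) (Ps : Set σ.Pred) (I : Interp σ U)
    (J K : Set (GAtom σ U)) (φ : Fm σ) : ∀ env : ℕ → U, FmOver Fs Ps φ →
    (qhtSat I (restrAt Ps J) (restrAt Ps K) env φ ↔ qhtSat I J K env φ) := by
  induction φ with
  | atom p ts => intro env h; exact ⟨fun h' => h'.1, fun h' => ⟨h', h.1⟩⟩
  | eq t₁ t₂ => intro env h; exact Iff.rfl
  | bot => intro env h; exact Iff.rfl
  | conj φ ψ ih1 ih2 => intro env h; exact and_congr (ih1 env h.1) (ih2 env h.2)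
  | disj φ ψ ih1 ih2 => intro env h; exact or_congr (ih1 env h.1) (ih2 env h.2)
  | impl φ ψ ih1 ih2 =>
    intro env h
    exact and_congr (imp_congr (ih1 env h.1) (ih2 env h.2))
      (imp_congr (clFoSat_restr Fs Ps I K φ env h.1) (clFoSat_restr Fs Ps I K ψ env h.2))
  | all φ ih =>
    intro env h
    exact forall_congr' fun d =>
      and_congr (ih (push d env) h) (clFoSat_restr Fs Ps I K φ (push d env) h)
  | ex φ ih => intro env h; exact exists_congr fun d => ih (push d env) h

/-- Let Γ be a theory over L, L' ⊃ L (the ambient signature σ plays the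
role of L', and L is given by the subsets Fs, Ps of its symbols), and M = ⟨I,J,K⟩ a
QHT-interpretation over L' whose restriction to L is totality preserving. If M is a
QHT-countermodel of Γ, then so is its restriction M|_L. -/
theorem fo_countermodel_restriction {U : Type} [Nonempty U]
    (Fs : Set σ.Func) (Ps : Set σ.Pred)
    (hproper : Fs ≠ Set.univ ∨ Ps ≠ Set.univ)
    (Γ : Set (Fm σ)) (hsen : ∀ φ ∈ Γ, Sentence φ)
    (hover : ∀ φ ∈ Γ, FmOver Fs Ps φ)
    (I : Interp σ U) (J K : Set (GAtom σ U)) (hJK : J ⊆ K)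
    (htp : J ⊂ K → restrAt Ps J ⊂ restrAt Ps K) :
    ¬ QSatT I J K Γ → ¬ QSatT I (restrAt Ps J) (restrAt Ps K) Γ := by
  intro hn hs
  exact hn fun φ hφ env => (qhtSat_restr Fs Ps I J K φ env (hover φ hφ)).1 (hs φ hφ env)
end
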